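/- arXiv:2603.03622 — 2 statements merged into one kernel-verified Lean document; each statement's English description precedes it below -/
import Mathlib

section
/- The partial sums of odd/even reciprocal-weight differences satisfy Σ_{i=0}^{n−1} (1/w(2i+1) − 1/w(2i)) ~ 2^{α−1}·n^α as n → ∞, i.e. the ratio of the left side to 2^{α−1}·n^α tends to 1. -/
open Filter

/-- The asymptotic condition `1/w(n) = n^α (1 + 2B/n + O(1/n²))` on the weight function. -/
def WeightAsymp (w : ℕ → ℝ) (α B : ℝ) : Prop :=
  ∃ C₀ > (0:ℝ), ∃ N₀ : ℕ, ∀ n : ℕ, N₀ ≤ n →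
    |1 / w n - (n:ℝ) ^ α - 2 * B * (n:ℝ) ^ (α - 1)| ≤ C₀ * (n:ℝ) ^ (α - 2)

lemma tendsto_rpow_add_one_div_rpow (p : ℝ) :
    Tendsto (fun m : ℕ => ((m + 1 : ℕ) : ℝ) ^ p / (m : ℝ) ^ p) atTop (nhds 1) := by
  have h : Tendsto (fun m : ℕ => (1 + 1 / (m : ℝ)) ^ p) atTop (nhds ((1 + 0) ^ p)) :=
    (tendsto_const_nhds.add tendsto_one_div_atTop_nhds_zero_nat).rpow_const (by norm_num)
  rw [add_zero, Real.one_rpow] at h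
  refine h.congr' ?_
  filter_upwards [eventually_gt_atTop 0] with m hm
  have hm' : (0 : ℝ) < m := by exact_mod_cast hm
  rw [← Real.div_rpow (by positivity) hm'.le]
  congr 1
  push_cast
  field_simp

lemma tendsto_rpow_add_one_sub_rpow_div (p : ℝ) :
    Tendsto (fun m : ℕ => (((m + 1 : ℕ) : ℝ) ^ p - (m : ℝ) ^ p) / (m : ℝ) ^ (p - 1))
      atTop (nhds p) := by
  have hd : HasDerivAt (fun x : ℝ => x ^ p) p 1 := by
    simpa using Real.hasDerivAt_rpow_const (x := 1) (p := p) (Or.inl one_ne_zero)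
  have ht : Tendsto (fun m : ℕ => 1 / (m : ℝ)) atTop (nhdsWithin 0 {0}ᶜ) := by
    refine tendsto_nhdsWithin_iff.2 ⟨tendsto_one_div_atTop_nhds_zero_nat, ?_⟩
    filter_upwards [eventually_gt_atTop 0] with m hm
    have hm' : (0 : ℝ) < m := by exact_mod_cast hm
    exact (one_div_pos.2 hm').ne'
  refine ((hasDerivAt_iff_tendsto_slope_zero.1 hd).comp ht).congr' ?_
  filter_upwards [eventually_gt_atTop 0] with m hm
  have hm' : (0 : ℝ) < m := by exact_mod_cast hm
  have h1 : ((m + 1 : ℕ) : ℝ) ^ p = (m : ℝ) ^ p * (1 + 1 / (m : ℝ)) ^ p := by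
    rw [← Real.mul_rpow hm'.le (by positivity)]
    congr 1
    push_cast
    field_simp
  have hp : (m : ℝ) ^ p ≠ 0 := (Real.rpow_pos_of_pos hm' p).ne'
  simp only [Function.comp, smul_eq_mul, Real.one_rpow]
  rw [h1, Real.rpow_sub_one hm'.ne']
  field_simp

lemma WeightAsymp.tendsto_sub_rpow_div {w : ℕ → ℝ} {α B : ℝ} (h : WeightAsymp w α B) :
    Tendsto (fun m : ℕ => (1 / w m - (m : ℝ) ^ α) / (m : ℝ) ^ (α - 1)) atTop (nhds (2 * B)) := by
  obtain ⟨C, -, N, hC⟩ := h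
  rw [tendsto_iff_norm_sub_tendsto_zero]
  have hz : Tendsto (fun m : ℕ => C * (1 / (m : ℝ))) atTop (nhds 0) := by
    simpa using tendsto_one_div_atTop_nhds_zero_nat.const_mul C
  refine squeeze_zero' (Eventually.of_forall fun _ => norm_nonneg _) ?_ hz
  filter_upwards [eventually_gt_atTop 0, eventually_ge_atTop N] with m hm hN
  have hm' : (0 : ℝ) < m := by exact_mod_cast hm
  have hp : 0 < (m : ℝ) ^ (α - 1) := Real.rpow_pos_of_pos hm' _
  have hC' := hC m hN
  rw [show α - 2 = α - 1 - 1 by ring, Real.rpow_sub_one hm'.ne' (α - 1)] at hC'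
  rw [Real.norm_eq_abs, div_sub' hp.ne', abs_div, abs_of_pos hp, div_le_iff₀ hp]
  calc _ = _ := by congr 1; ring
    _ ≤ _ := hC'
    _ = _ := by ring

lemma WeightAsymp.tendsto_diff_div {w : ℕ → ℝ} {α B : ℝ} (h : WeightAsymp w α B) :
    Tendsto (fun m : ℕ => (1 / w (m + 1) - 1 / w m) / (m : ℝ) ^ (α - 1)) atTop (nhds α) := by
  have hr := h.tendsto_sub_rpow_div
  have hs := (hr.comp (tendsto_add_atTop_nat 1)).mul (tendsto_rpow_add_one_div_rpow (α - 1))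
  have := (tendsto_rpow_add_one_sub_rpow_div α).add (hs.sub hr)
  rw [mul_one, sub_self, add_zero] at this
  refine this.congr fun m => ?_
  have hp : ((m + 1 : ℕ) : ℝ) ^ (α - 1) ≠ 0 := (Real.rpow_pos_of_pos (by positivity) _).ne'
  simp only [Function.comp]
  rw [div_mul_div_cancel₀ hp]
  ring

theorem sum_reciprocal_weight_diff_asymp (α B : ℝ) (hα : 0 < α)
    (w : ℕ → ℝ) (hw : ∀ n, 0 < w n) (hasymp : WeightAsymp w α B) :
    Tendsto (fun n : ℕ =>
        (∑ i ∈ Finset.range n, (1 / w (2*i+1) - 1 / w (2*i))) /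
          ((2:ℝ) ^ (α - 1) * (n:ℝ) ^ α))
      atTop (nhds 1) := by
  have hc : (0 : ℝ) < 2 ^ (α - 1) := Real.rpow_pos_of_pos two_pos _
  set d : ℕ → ℝ := fun i => 1 / w (2*i+1) - 1 / w (2*i) with hd
  set g : ℕ → ℝ := fun i => 2 ^ (α - 1) * (((i + 1 : ℕ) : ℝ) ^ α - (i : ℝ) ^ α) with hg
  have hgpos : ∀ i, 0 < g i := fun i =>
    mul_pos hc (sub_pos.2 (Real.rpow_lt_rpow (by positivity) (by push_cast; linarith) hα))
  have hgsum : ∀ n, ∑ i ∈ Finset.range n, g i = 2 ^ (α - 1) * (n : ℝ) ^ α := fun n => by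
    rw [hg, ← Finset.mul_sum, Finset.sum_range_sub (fun i : ℕ => (i : ℝ) ^ α)]
    simp [Real.zero_rpow hα.ne']
  have hgtop : Tendsto (fun n => ∑ i ∈ Finset.range n, g i) atTop atTop := by
    simp only [hgsum]
    exact ((tendsto_rpow_atTop hα).comp tendsto_natCast_atTop_atTop).const_mul_atTop hc
  have hdg : Tendsto (fun i => d i / g i) atTop (nhds 1) := by
    have h1 := hasymp.tendsto_diff_div.comp
      (tendsto_id.const_mul_atTop' (two_pos : (0 : ℕ) < 2))
    have h2 := h1.div (tendsto_rpow_add_one_sub_rpow_div α) hα.ne'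
    rw [div_self hα.ne'] at h2
    refine h2.congr' ?_
    filter_upwards [eventually_gt_atTop 0] with m hm
    have hm' : (0 : ℝ) < m := by exact_mod_cast hm
    have hp : (m : ℝ) ^ (α - 1) ≠ 0 := (Real.rpow_pos_of_pos hm' _).ne'
    simp only [Function.comp, Pi.div_apply, id, hd, hg]
    rw [Nat.cast_mul, Nat.cast_ofNat, Real.mul_rpow two_pos.le hm'.le, div_div_eq_mul_div,
      ← mul_div_right_comm, mul_div_mul_right _ _ hp, div_div]
  have hequiv : Asymptotics.IsEquivalent atTop d g :=
    (Asymptotics.isEquivalent_iff_tendsto_one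
      (Eventually.of_forall fun i => (hgpos i).ne')).2 hdg
  have hsum := hequiv.isLittleO.sum_range (fun i => (hgpos i).le) hgtop
  have hsequiv : Asymptotics.IsEquivalent atTop (fun n => ∑ i ∈ Finset.range n, d i)
      (fun n => ∑ i ∈ Finset.range n, g i) := by
    refine hsum.congr_left fun n => ?_
    simp [Finset.sum_sub_distrib]
  have := (Asymptotics.isEquivalent_iff_tendsto_one
    ((hgtop.eventually_gt_atTop 0).mono fun n hn => hn.ne')).1 hsequiv
  exact this.congr fun n => by simp only [Pi.div_apply, hgsum]
end

section
/- For every n ≥ 1, the expected harmonic-type sum over red draws up to the n-th blue draw satisfies E[Σ_{j=0}^{ℜ_{τ_n^𝔅}−1} 1/r(j)] = Σ_{j=0}^{n−1} 1/b(j). -/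
open MeasureTheory ProbabilityTheory Filter

/-- The three admissible choices of `(b, r)` in terms of the weight function `w`. -/
def UrnChoice (w b r : ℕ → ℝ) : Prop :=
  (∀ i, b i = w (2*i) ∧ r i = w (2*i+1)) ∨
  (∀ i, b i = w (2*i+1) ∧ r i = w (2*i)) ∨
  (∀ i, b i = w (2*i) ∧ r i = w (2*i))

/-- A generalized Pólya urn process: `Bl n` and `Re n` are the numbers of blue and red
balls drawn in the first `n` draws; started at `(0,0)`, exactly one coordinate increases
by `1` at each step, and conditionally on the past the blue coordinate increases with
probability `b(Bl n)/(b(Bl n) + r(Re n))`. -/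
structure Urn {Ω : Type*} [MeasurableSpace Ω] (μ : Measure Ω) (b r : ℕ → ℝ) where
  Bl : ℕ → Ω → ℕ
  Re : ℕ → Ω → ℕ
  meas_Bl : ∀ n, Measurable (Bl n)
  meas_Re : ∀ n, Measurable (Re n)
  init_Bl : ∀ ω, Bl 0 ω = 0
  init_Re : ∀ ω, Re 0 ω = 0
  step : ∀ n ω, (Bl (n+1) ω = Bl n ω + 1 ∧ Re (n+1) ω = Re n ω) ∨
                (Bl (n+1) ω = Bl n ω ∧ Re (n+1) ω = Re n ω + 1)
  markov : ∀ n : ℕ,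
    μ[(fun ω => if Bl (n+1) ω = Bl n ω + 1 then (1:ℝ) else 0) |
        ⨆ j ∈ Set.Iic n, MeasurableSpace.comap (fun ω => (Bl j ω, Re j ω)) inferInstance]
      =ᵐ[μ] fun ω => b (Bl n ω) / (b (Bl n ω) + r (Re n ω))

namespace Urn

variable {Ω : Type*} [MeasurableSpace Ω] {μ : Measure Ω} {b r : ℕ → ℝ}

/-- The discrepancy `𝔇_n = ℜ_n − 𝔅_n`. -/
def D (U : Urn μ b r) (n : ℕ) (ω : Ω) : ℤ := (U.Re n ω : ℤ) - (U.Bl n ω : ℤ)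

/-- `τ_k^𝔅`, the number of draws until the `k`-th blue ball. -/
noncomputable def tau (U : Urn μ b r) : ℕ → Ω → ℕ
  | 0 => fun _ => 0
  | k+1 => fun ω => sInf {n : ℕ | U.tau k ω < n ∧ U.Bl n ω = U.Bl (n-1) ω + 1}

/-- The natural filtration `ℱ_n = σ((𝔅_j, ℜ_j), j ≤ n)`. -/
def F (U : Urn μ b r) (n : ℕ) : MeasurableSpace Ω :=
  ⨆ j ∈ Set.Iic n, MeasurableSpace.comap (fun ω => (U.Bl j ω, U.Re j ω)) inferInstance

end Urn

namespace Urn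

variable {Ω : Type*} [MeasurableSpace Ω] {μ : Measure Ω} {b r : ℕ → ℝ}

lemma Bl_mono (U : Urn μ b r) (ω : Ω) : Monotone (fun n => U.Bl n ω) :=
  monotone_nat_of_le_succ fun n => by rcases U.step n ω with h | h <;> omega

lemma Bl_add_Re (U : Urn μ b r) (n : ℕ) (ω : Ω) : U.Bl n ω + U.Re n ω = n := by
  induction n with
  | zero => simp [U.init_Bl, U.init_Re]
  | succ n ih => rcases U.step n ω with h | h <;> omega

/-- If the `k`-th blue ball is ever drawn, then `τ_k^𝔅` is the first time there are `k` of them. -/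
lemma tau_spec (U : Urn μ b r) (ω : Ω) (k : ℕ) (h : ∃ n, k ≤ U.Bl n ω) :
    U.Bl (U.tau k ω) ω = k ∧ ∀ m < U.tau k ω, U.Bl m ω < k := by
  induction k with
  | zero => simp [tau, U.init_Bl]
  | succ k ih =>
    obtain ⟨hk, -⟩ := ih (h.imp fun n hn => by omega)
    obtain ⟨N, hN⟩ : ∃ N, N = Nat.find h := ⟨_, rfl⟩
    have hN1 : k + 1 ≤ U.Bl N ω := hN ▸ Nat.find_spec h
    have hN2 : ∀ m < N, U.Bl m ω < k + 1 := fun m hm => by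
      simpa using Nat.find_min h (hN ▸ hm)
    have hlt : U.tau k ω < N := by
      by_contra! hle
      have : U.Bl N ω ≤ U.Bl (U.tau k ω) ω := U.Bl_mono ω hle
      omega
    have hpred := hN2 (N - 1) (by omega)
    have hstep := U.step (N - 1) ω
    rw [Nat.sub_add_cancel (by omega : 1 ≤ N)] at hstep
    have hmem : N ∈ {n : ℕ | U.tau k ω < n ∧ U.Bl n ω = U.Bl (n-1) ω + 1} :=
      ⟨hlt, by omega⟩
    have htau : U.tau (k + 1) ω = N := by
      refine le_antisymm (Nat.sInf_le hmem) (le_csInf ⟨N, hmem⟩ ?_)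
      rintro n ⟨h1, h2⟩
      by_contra! hn
      have h3 : U.Bl (U.tau k ω) ω ≤ U.Bl (n - 1) ω := U.Bl_mono ω (by omega)
      have := hN2 n hn
      omega
    rw [htau]
    exact ⟨by omega, hN2⟩

lemma F_le (U : Urn μ b r) (n : ℕ) : U.F n ≤ (inferInstance : MeasurableSpace Ω) :=
  iSup₂_le fun j _ => ((U.meas_Bl j).prodMk (U.meas_Re j)).comap_le

lemma stronglyMeasurable_F (U : Urn μ b r) (n : ℕ) (h : ℕ × ℕ → ℝ) :
    StronglyMeasurable[U.F n] (fun ω => h (U.Bl n ω, U.Re n ω)) := by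
  refine Measurable.stronglyMeasurable ?_
  have h1 : Measurable[U.F n] (fun ω => (U.Bl n ω, U.Re n ω)) :=
    (comap_measurable _).mono
      (le_iSup₂_of_le (f := fun j (_ : j ∈ Set.Iic n) => MeasurableSpace.comap
        (fun ω => (U.Bl j ω, U.Re j ω)) inferInstance) n Set.self_mem_Iic le_rfl) le_rfl
  exact (measurable_of_countable h).comp h1

lemma exists_bound (U : Urn μ b r) (n : ℕ) (h : ℕ × ℕ → ℝ) :
    ∃ C : ℝ, ∀ ω, ‖h (U.Bl n ω, U.Re n ω)‖ ≤ C := by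
  refine ⟨∑ p ∈ Finset.range (n + 1) ×ˢ Finset.range (n + 1), ‖h p‖, fun ω => ?_⟩
  have := U.Bl_add_Re n ω
  exact Finset.single_le_sum (f := fun p => ‖h p‖) (fun _ _ => norm_nonneg _)
    (by simp only [Finset.mem_product, Finset.mem_range]; omega)

lemma integrable_state [IsProbabilityMeasure μ] (U : Urn μ b r) (n : ℕ) (h : ℕ × ℕ → ℝ) :
    Integrable (fun ω => h (U.Bl n ω, U.Re n ω)) μ := by
  obtain ⟨C, hC⟩ := U.exists_bound n h
  exact Integrable.of_bound
    ((U.stronglyMeasurable_F n h).mono (U.F_le n)).aestronglyMeasurable C (.of_forall hC)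

/-- The indicator that draw `n + 1` is blue. -/
def blueInd (U : Urn μ b r) (n : ℕ) (ω : Ω) : ℝ :=
  if U.Bl (n+1) ω = U.Bl n ω + 1 then 1 else 0

lemma measurable_blueInd (U : Urn μ b r) (n : ℕ) : Measurable (U.blueInd n) :=
  Measurable.ite (measurableSet_eq_fun (U.meas_Bl _) ((U.meas_Bl n).add_const 1))
    measurable_const measurable_const

lemma blueInd_nonneg (U : Urn μ b r) (n : ℕ) (ω : Ω) : 0 ≤ U.blueInd n ω := by
  unfold blueInd; split_ifs <;> simp

lemma blueInd_le_one (U : Urn μ b r) (n : ℕ) (ω : Ω) : U.blueInd n ω ≤ 1 := by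
  unfold blueInd; split_ifs <;> simp

lemma norm_blueInd_le (U : Urn μ b r) (n : ℕ) (ω : Ω) : ‖U.blueInd n ω‖ ≤ 1 := by
  rw [Real.norm_of_nonneg (U.blueInd_nonneg n ω)]; exact U.blueInd_le_one n ω

lemma integrable_state_mul_blueInd [IsProbabilityMeasure μ] (U : Urn μ b r) (n : ℕ)
    (h : ℕ × ℕ → ℝ) :
    Integrable (fun ω => h (U.Bl n ω, U.Re n ω) * U.blueInd n ω) μ :=
  (U.integrable_state n h).mul_bdd (c := 1) (U.measurable_blueInd n).aestronglyMeasurable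
    (.of_forall (U.norm_blueInd_le n))

/-- The Markov property, tested against functions of the current state. -/
lemma integral_state_mul_blueInd [IsProbabilityMeasure μ] (U : Urn μ b r) (n : ℕ)
    (h : ℕ × ℕ → ℝ) :
    ∫ ω, h (U.Bl n ω, U.Re n ω) * U.blueInd n ω ∂μ =
      ∫ ω, h (U.Bl n ω, U.Re n ω) * (b (U.Bl n ω) / (b (U.Bl n ω) + r (U.Re n ω))) ∂μ := by
  have hI : Integrable (U.blueInd n) μ :=
    Integrable.of_bound (U.measurable_blueInd n).aestronglyMeasurable 1
      (.of_forall (U.norm_blueInd_le n))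
  have h1 := condExp_mul_of_stronglyMeasurable_left (U.stronglyMeasurable_F n h)
    (U.integrable_state_mul_blueInd n h) hI
  rw [← integral_condExp (U.F_le n)]
  refine integral_congr_ae ?_
  filter_upwards [h1, U.markov n] with ω h2 h3
  exact h2.trans (congrArg (h (U.Bl n ω, U.Re n ω) * ·) h3)

/-- The contribution `1 / b` of draw `m + 1`, if it is one of the first `k` blue draws. -/
noncomputable def blueTerm (U : Urn μ b r) (k m : ℕ) (ω : Ω) : ℝ :=
  (if U.Bl m ω < k then 1 / b (U.Bl m ω) else 0) * U.blueInd m ω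

/-- The contribution `1 / r` of draw `m + 1`, if it is red and precedes the `k`-th blue draw. -/
noncomputable def redTerm (U : Urn μ b r) (k m : ℕ) (ω : Ω) : ℝ :=
  (if U.Bl m ω < k then 1 / r (U.Re m ω) else 0) * (1 - U.blueInd m ω)

lemma blueTerm_nonneg (U : Urn μ b r) (hb : ∀ i, 0 < b i) (k m : ℕ) (ω : Ω) :
    0 ≤ U.blueTerm k m ω := by
  refine mul_nonneg ?_ (U.blueInd_nonneg m ω)
  split_ifs
  · exact (one_div_pos.2 (hb _)).le
  · exact le_rfl

lemma redTerm_nonneg (U : Urn μ b r) (hr : ∀ i, 0 < r i) (k m : ℕ) (ω : Ω) :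
    0 ≤ U.redTerm k m ω := by
  refine mul_nonneg ?_ (sub_nonneg.2 (U.blueInd_le_one m ω))
  split_ifs
  · exact (one_div_pos.2 (hr _)).le
  · exact le_rfl

lemma integrable_blueTerm [IsProbabilityMeasure μ] (U : Urn μ b r) (k m : ℕ) :
    Integrable (U.blueTerm k m) μ :=
  U.integrable_state_mul_blueInd m fun p => if p.1 < k then 1 / b p.1 else 0

lemma integrable_redTerm [IsProbabilityMeasure μ] (U : Urn μ b r) (k m : ℕ) :
    Integrable (U.redTerm k m) μ := by
  have := (U.integrable_state m fun p => if p.1 < k then 1 / r p.2 else 0).sub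
    (U.integrable_state_mul_blueInd m fun p => if p.1 < k then 1 / r p.2 else 0)
  refine this.congr (.of_forall fun ω => ?_)
  simp only [redTerm, Pi.sub_apply]
  ring

lemma integral_redTerm [IsProbabilityMeasure μ] (U : Urn μ b r) (hb : ∀ i, 0 < b i)
    (hr : ∀ i, 0 < r i) (k m : ℕ) :
    ∫ ω, U.redTerm k m ω ∂μ = ∫ ω, U.blueTerm k m ω ∂μ := by
  let φ : ℕ × ℕ → ℝ := fun p => if p.1 < k then 1 / b p.1 else 0
  let ψ : ℕ × ℕ → ℝ := fun p => if p.1 < k then 1 / r p.2 else 0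
  have hred : ∫ ω, U.redTerm k m ω ∂μ =
      ∫ ω, ψ (U.Bl m ω, U.Re m ω) - ψ (U.Bl m ω, U.Re m ω) * U.blueInd m ω ∂μ :=
    integral_congr_ae (.of_forall fun ω => by simp only [redTerm, ψ]; ring)
  have hblue := U.integral_state_mul_blueInd m φ
  rw [hred, integral_sub (U.integrable_state m ψ) (U.integrable_state_mul_blueInd m ψ),
    U.integral_state_mul_blueInd m ψ, ← integral_sub (U.integrable_state m ψ)
      (U.integrable_state m fun p => ψ p * (b p.1 / (b p.1 + r p.2)))]
  refine Eq.trans (integral_congr_ae (.of_forall fun ω => ?_)) hblue.symm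
  have h1 := hb (U.Bl m ω)
  have h2 := hr (U.Re m ω)
  have h3 := add_pos h1 h2
  by_cases hk : U.Bl m ω < k
  · simp only [φ, ψ, hk, if_true]
    field_simp
    ring
  · simp [φ, ψ, hk]

lemma sum_redTerm (U : Urn μ b r) (k n : ℕ) (ω : Ω) (h : ∀ m < n, U.Bl m ω < k) :
    ∑ m ∈ Finset.range n, U.redTerm k m ω = ∑ j ∈ Finset.range (U.Re n ω), 1 / r j := by
  induction n with
  | zero => simp [U.init_Re]
  | succ n ih =>
    rw [Finset.sum_range_succ, ih fun m hm => h m (by omega)]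
    rcases U.step n ω with ⟨h1, h2⟩ | ⟨h1, h2⟩
    · simp [redTerm, blueInd, h1, h2]
    · simp [redTerm, blueInd, h1, h2, h n, Finset.sum_range_succ]

lemma sum_blueTerm (U : Urn μ b r) (k n : ℕ) (ω : Ω) (h : ∀ m < n, U.Bl m ω < k) :
    ∑ m ∈ Finset.range n, U.blueTerm k m ω = ∑ j ∈ Finset.range (U.Bl n ω), 1 / b j := by
  induction n with
  | zero => simp [U.init_Bl]
  | succ n ih =>
    rw [Finset.sum_range_succ, ih fun m hm => h m (by omega)]
    rcases U.step n ω with ⟨h1, h2⟩ | ⟨h1, h2⟩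
    · simp [blueTerm, blueInd, h1, h n, Finset.sum_range_succ]
    · simp [blueTerm, blueInd, h1]

lemma tsum_terms_of_exists (U : Urn μ b r) (hb : ∀ i, 0 < b i) (hr : ∀ i, 0 < r i)
    (k : ℕ) (ω : Ω) (h : ∃ n, k ≤ U.Bl n ω) :
    ∑' m, ENNReal.ofReal (U.redTerm k m ω) =
        ENNReal.ofReal (∑ j ∈ Finset.range (U.Re (U.tau k ω) ω), 1 / r j) ∧
      ∑' m, ENNReal.ofReal (U.blueTerm k m ω) =
        ENNReal.ofReal (∑ j ∈ Finset.range k, 1 / b j) := by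
  obtain ⟨h1, h2⟩ := U.tau_spec ω k h
  have h3 : ∀ m ∉ Finset.range (U.tau k ω), ¬ U.Bl m ω < k := fun m hm => by
    have : U.Bl (U.tau k ω) ω ≤ U.Bl m ω := U.Bl_mono ω (by simpa using hm)
    omega
  have hB := U.sum_blueTerm k _ ω h2
  rw [h1] at hB
  rw [← U.sum_redTerm k _ ω h2, ← hB,
    ENNReal.ofReal_sum_of_nonneg fun m _ => U.redTerm_nonneg hr k m ω,
    ENNReal.ofReal_sum_of_nonneg fun m _ => U.blueTerm_nonneg hb k m ω]
  exact ⟨tsum_eq_sum fun m hm => by simp [redTerm, h3 m hm],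
    tsum_eq_sum fun m hm => by simp [blueTerm, h3 m hm]⟩

lemma tsum_blueTerm_le (U : Urn μ b r) (hb : ∀ i, 0 < b i) (hr : ∀ i, 0 < r i)
    (k : ℕ) (ω : Ω) :
    ∑' m, ENNReal.ofReal (U.blueTerm k m ω) ≤
      ENNReal.ofReal (∑ j ∈ Finset.range k, 1 / b j) := by
  by_cases h : ∃ n, k ≤ U.Bl n ω
  · exact (U.tsum_terms_of_exists hb hr k ω h).2.le
  · push Not at h
    refine ENNReal.tsum_le_of_sum_range_le fun n => ?_
    rw [← ENNReal.ofReal_sum_of_nonneg fun m _ => U.blueTerm_nonneg hb k m ω,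
      U.sum_blueTerm k n ω fun m _ => h m]
    refine ENNReal.ofReal_le_ofReal (Finset.sum_le_sum_of_subset_of_nonneg ?_ ?_)
    · exact Finset.range_mono (h n).le
    · exact fun i _ _ => (one_div_pos.2 (hb i)).le

lemma tsum_redTerm_eq_top (U : Urn μ b r) (hr : ∀ i, 0 < r i)
    (hdivr : ¬ Summable (fun j => 1 / r j)) (k : ℕ) (ω : Ω) (h : ∀ n, U.Bl n ω < k) :
    ∑' m, ENNReal.ofReal (U.redTerm k m ω) = ⊤ := by
  by_contra htop
  refine hdivr (summable_of_sum_range_le (c := (∑' m, ENNReal.ofReal (U.redTerm k m ω)).toReal)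
    (fun i => (one_div_pos.2 (hr i)).le) fun n => ?_)
  rw [← ENNReal.ofReal_le_iff_le_toReal htop]
  refine le_trans ?_ (ENNReal.sum_le_tsum (Finset.range (n + k)))
  rw [← ENNReal.ofReal_sum_of_nonneg fun m _ => U.redTerm_nonneg hr k m ω,
    U.sum_redTerm k _ ω fun m _ => h m]
  refine ENNReal.ofReal_le_ofReal (Finset.sum_le_sum_of_subset_of_nonneg ?_ ?_)
  · have h1 := U.Bl_add_Re (n + k) ω
    have h2 := h (n + k)
    exact Finset.range_mono (by omega)
  · exact fun i _ _ => (one_div_pos.2 (hr i)).le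

lemma lintegral_tsum_redTerm [IsProbabilityMeasure μ] (U : Urn μ b r) (hb : ∀ i, 0 < b i)
    (hr : ∀ i, 0 < r i) (k : ℕ) :
    ∫⁻ ω, ∑' m, ENNReal.ofReal (U.redTerm k m ω) ∂μ =
      ∫⁻ ω, ∑' m, ENNReal.ofReal (U.blueTerm k m ω) ∂μ := by
  rw [lintegral_tsum fun m => (U.integrable_redTerm k m).aemeasurable.ennreal_ofReal,
    lintegral_tsum fun m => (U.integrable_blueTerm k m).aemeasurable.ennreal_ofReal]
  refine tsum_congr fun m => ?_
  rw [← ofReal_integral_eq_lintegral_ofReal (U.integrable_redTerm k m)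
      (.of_forall (U.redTerm_nonneg hr k m)),
    ← ofReal_integral_eq_lintegral_ofReal (U.integrable_blueTerm k m)
      (.of_forall (U.blueTerm_nonneg hb k m)), U.integral_redTerm hb hr]

end Urn

theorem toth_lemma_mean_harmonic_sum {Ω : Type*} [MeasurableSpace Ω]
    (μ : MeasureTheory.Measure Ω) [MeasureTheory.IsProbabilityMeasure μ]
    (b r : ℕ → ℝ) (hb : ∀ i, 0 < b i) (hr : ∀ i, 0 < r i)
    (hbound : ∃ K : ℝ, ∀ i, b i ≤ K ∧ r i ≤ K)
    (hdivb : ¬ Summable (fun j => 1 / b j)) (hdivr : ¬ Summable (fun j => 1 / r j))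
    (U : Urn μ b r) :
    ∀ n : ℕ, 1 ≤ n →
      (∫ ω, (∑ j ∈ Finset.range (U.Re (U.tau n ω) ω), 1 / r j) ∂μ)
        = ∑ j ∈ Finset.range n, 1 / b j := by
  intro n _
  have hlint := U.lintegral_tsum_redTerm hb hr n
  have hmeas : AEMeasurable (fun ω => ∑' m, ENNReal.ofReal (U.redTerm n m ω)) μ :=
    AEMeasurable.tsum fun m => (U.integrable_redTerm n m).aemeasurable.ennreal_ofReal
  have hfin : ∫⁻ ω, ∑' m, ENNReal.ofReal (U.redTerm n m ω) ∂μ ≠ ⊤ := by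
    rw [hlint]
    refine ((lintegral_mono (U.tsum_blueTerm_le hb hr n)).trans_lt ?_).ne
    simp
  have hlt := ae_lt_top' hmeas hfin
  have hex : ∀ᵐ ω ∂μ, ∃ m, n ≤ U.Bl m ω := by
    filter_upwards [hlt] with ω hω
    by_contra! h
    exact hω.ne (U.tsum_redTerm_eq_top hr hdivr n ω h)
  have hblue : ∫⁻ ω, ∑' m, ENNReal.ofReal (U.blueTerm n m ω) ∂μ =
      ENNReal.ofReal (∑ j ∈ Finset.range n, 1 / b j) := by
    rw [lintegral_congr_ae (hex.mono fun ω h => (U.tsum_terms_of_exists hb hr n ω h).2)]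
    simp
  have hred : (fun ω => ∑ j ∈ Finset.range (U.Re (U.tau n ω) ω), 1 / r j) =ᵐ[μ]
      fun ω => (∑' m, ENNReal.ofReal (U.redTerm n m ω)).toReal := by
    filter_upwards [hex] with ω h
    rw [(U.tsum_terms_of_exists hb hr n ω h).1, ENNReal.toReal_ofReal]
    exact Finset.sum_nonneg fun i _ => (one_div_pos.2 (hr i)).le
  rw [integral_congr_ae hred, integral_toReal hmeas hlt, hlint, hblue, ENNReal.toReal_ofReal]
  exact Finset.sum_nonneg fun i _ => (one_div_pos.2 (hb i)).le
end
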